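/- A channel ν from A to B is R-AMS with respect to every recurrent and AMS source if and only if it is R-AMS with respect to every stationary source; that is, the hookup μν is recurrent and AMS under T_{AB} for every probability measure μ on A that is recurrent and AMS under T_A if and only if μν is recurrent and AMS under T_{AB} for every probability measure μ on A that is stationary under T_A. -/

import Mathlib

open MeasureTheory ProbabilityTheory Filter

/-- A probability measure `η` is stationary under `T` if `η (T ⁻¹' F) = η F`
for all measurable `F`. -/
def Stationary {α : Type*} [MeasurableSpace α] (T : α → α)
    (η : MeasureTheory.Measure α) : Prop :=
  ∀ F : Set α, MeasurableSet F → η (T ⁻¹' F) = η F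

/-- A probability measure `η` is recurrent under `T` if
`η (F \ ⋃_{k ≥ 1} T^{-k} F) = 0` for all measurable `F`. -/
def Recurrent {α : Type*} [MeasurableSpace α] (T : α → α)
    (η : MeasureTheory.Measure α) : Prop :=
  ∀ F : Set α, MeasurableSet F → η (F \ ⋃ k : ℕ, (T^[k + 1]) ⁻¹' F) = 0

/-- A probability measure `η` is asymptotically mean stationary (AMS) under `T` if the
Cesàro averages `(1/n) ∑_{k<n} η (T^{-k} F)` converge for every measurable `F`. -/
def IsAMS {α : Type*} [MeasurableSpace α] (T : α → α)
    (η : MeasureTheory.Measure α) : Prop :=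
  ∀ F : Set α, MeasurableSet F → ∃ L : ℝ,
    Filter.Tendsto
      (fun n : ℕ => (∑ k ∈ Finset.range n, (η ((T^[k]) ⁻¹' F)).toReal) / (n : ℝ))
      Filter.atTop (nhds L)

/-- `η'` is the stationary mean of `η` under `T`: the Cesàro averages
`(1/n) ∑_{k<n} η (T^{-k} F)` converge to `η' F` for every measurable `F`. -/
def IsStationaryMean {α : Type*} [MeasurableSpace α] (T : α → α)
    (η η' : MeasureTheory.Measure α) : Prop :=
  ∀ F : Set α, MeasurableSet F →
    Filter.Tendsto
      (fun n : ℕ => (∑ k ∈ Finset.range n, (η ((T^[k]) ⁻¹' F)).toReal) / (n : ℝ))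
      Filter.atTop (nhds ((η' F).toReal))

/-- A probability measure `η` is ergodic under `T` if every strictly invariant
measurable set has measure `0` or `1`. -/
def ErgodicShift {α : Type*} [MeasurableSpace α] (T : α → α)
    (η : MeasureTheory.Measure α) : Prop :=
  ∀ F : Set α, MeasurableSet F → T ⁻¹' F = F → η F = 0 ∨ η F = 1

open Topology

section MeanErgodic

variable {α : Type*} [MeasurableSpace α]

theorem Stationary.measurePreserving {T : α → α} {m : Measure α} (h : Stationary T m)
    (hT : Measurable T) : MeasurePreserving T m m :=
  ⟨hT, Measure.ext fun F hF => by rw [Measure.map_apply hT hF, h F hF]⟩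

/-- A real sequence that is uniformly approximated by convergent sequences converges. -/
theorem exists_tendsto_of_forall_approx {a : ℕ → ℝ}
    (h : ∀ ε > 0, ∃ b : ℕ → ℝ, (∃ l, Tendsto b atTop (𝓝 l)) ∧ ∀ n, |a n - b n| ≤ ε) :
    ∃ l, Tendsto a atTop (𝓝 l) := by
  apply cauchySeq_tendsto_of_complete
  rw [Metric.cauchySeq_iff']
  intro ε hε
  obtain ⟨b, ⟨l, hb⟩, hab⟩ := h (ε / 4) (by positivity)
  obtain ⟨N, hN⟩ := Metric.cauchySeq_iff'.1 hb.cauchySeq (ε / 4) (by positivity)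
  refine ⟨N, fun n hn => ?_⟩
  have h1 := abs_le.1 (hab n)
  have h2 := abs_le.1 (hab N)
  have h3 := abs_lt.1 (by simpa [Real.dist_eq] using hN n hn)
  rw [Real.dist_eq, abs_lt]
  constructor <;> linarith

theorem abs_sum_range_div_le {a : ℕ → ℝ} {ε : ℝ} (h : ∀ k, |a k| ≤ ε) (n : ℕ) :
    |(∑ k ∈ Finset.range n, a k) / (n : ℝ)| ≤ ε := by
  have hε : 0 ≤ ε := (abs_nonneg _).trans (h 0)
  rw [abs_div, Nat.abs_cast]
  refine div_le_of_le_mul₀ (by positivity) hε ?_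
  calc |∑ k ∈ Finset.range n, a k| ≤ ∑ k ∈ Finset.range n, |a k| := Finset.abs_sum_le_sum_abs _ _
    _ ≤ ∑ _k ∈ Finset.range n, ε := Finset.sum_le_sum fun k _ => h k
    _ = ε * n := by simp [mul_comm]

/-- Weak mean ergodic theorem for indicators, tested against square-integrable functions. -/
theorem exists_tendsto_average_setIntegral_of_memLp_two {T : α → α} {m : Measure α}
    [IsFiniteMeasure m] (hT : MeasurePreserving T m m) {g : α → ℝ} (hg : MemLp g 2 m)
    {F : Set α} (hF : MeasurableSet F) :
    ∃ l : ℝ, Tendsto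
      (fun n : ℕ => (∑ k ∈ Finset.range n, ∫ x in T^[k] ⁻¹' F, g x ∂m) / (n : ℝ))
      atTop (𝓝 l) := by
  set U := Lp.compMeasurePreservingₗᵢ ℝ (E := ℝ) (p := 2) T hT
  have hU := U.toContinuousLinearMap.tendsto_birkhoffAverage_orthogonalProjection
    U.norm_toContinuousLinearMap_le (indicatorConstLp 2 hF (measure_ne_top m F) (1 : ℝ))
  have hiter : ∀ k : ℕ, U.toContinuousLinearMap^[k]
      (indicatorConstLp 2 hF (measure_ne_top m F) (1 : ℝ)) =
      indicatorConstLp 2 (hT.measurable.iterate k hF) (measure_ne_top m _) (1 : ℝ) := by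
    intro k
    induction k with
    | zero => rfl
    | succ k ih =>
      rw [Function.iterate_succ_apply', ih]
      exact Lp.indicatorConstLp_compMeasurePreserving (hT.measurable.iterate k hF)
        (measure_ne_top m _) (1 : ℝ) hT
  refine ⟨_, (hU.inner (𝕜 := ℝ) (tendsto_const_nhds (x := hg.toLp g))).congr fun n => ?_⟩
  simp only [birkhoffAverage, birkhoffSum, id, hiter, real_inner_smul_left, sum_inner]
  rw [div_eq_inv_mul]
  congr 1
  refine Finset.sum_congr rfl fun k _ => ?_
  rw [L2.inner_indicatorConstLp_one]
  exact integral_congr_ae (ae_restrict_of_ae hg.coeFn_toLp)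

theorem exists_tendsto_average_setIntegral {T : α → α} {m : Measure α}
    [IsFiniteMeasure m] (hT : MeasurePreserving T m m) {f : α → ℝ} (hf : Integrable f m)
    {F : Set α} (hF : MeasurableSet F) :
    ∃ l : ℝ, Tendsto
      (fun n : ℕ => (∑ k ∈ Finset.range n, ∫ x in T^[k] ⁻¹' F, f x ∂m) / (n : ℝ))
      atTop (𝓝 l) := by
  refine exists_tendsto_of_forall_approx fun ε hε => ?_
  obtain ⟨g, hfg, hg⟩ := (memLp_one_iff_integrable.2 hf).exists_simpleFunc_eLpNorm_sub_lt
    ENNReal.one_ne_top (ENNReal.ofReal_pos.2 hε).ne'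
  have hgi : Integrable g m := memLp_one_iff_integrable.1 hg
  refine ⟨_, exists_tendsto_average_setIntegral_of_memLp_two hT
    (g.memLp_of_isFiniteMeasure 2 m) hF, fun n => ?_⟩
  rw [← sub_div, ← Finset.sum_sub_distrib]
  refine abs_sum_range_div_le (fun k => ?_) n
  rw [← integral_sub hf.integrableOn hgi.integrableOn]
  calc |∫ x in T^[k] ⁻¹' F, f x - g x ∂m| ≤ ∫ x in T^[k] ⁻¹' F, ‖f x - g x‖ ∂m :=
        (Real.norm_eq_abs _).symm.trans_le (norm_integral_le_integral_norm _)
    _ ≤ ∫ x, ‖(f - g) x‖ ∂m :=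
        setIntegral_le_integral (hf.sub hgi).norm (Eventually.of_forall fun _ => norm_nonneg _)
    _ ≤ ε := by
        rw [integral_norm_eq_lintegral_enorm (hf.sub hgi).aestronglyMeasurable,
          ← eLpNorm_one_eq_lintegral_enorm]
        exact ENNReal.toReal_le_of_le_ofReal hε.le hfg.le

/-- A finite measure dominated by a finite stationary measure is AMS. -/
theorem IsAMS.of_absolutelyContinuous {T : α → α} {η m : Measure α} [IsFiniteMeasure η]
    [IsFiniteMeasure m] (hT : Measurable T) (hm : Stationary T m) (h : η ≪ m) : IsAMS T η := by
  intro F hF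
  obtain ⟨l, hl⟩ := exists_tendsto_average_setIntegral (hm.measurePreserving hT)
    (Measure.integrable_toReal_rnDeriv (μ := η) (ν := m)) hF
  refine ⟨l, hl.congr fun n => ?_⟩
  congr 1
  exact Finset.sum_congr rfl fun k _ => Measure.setIntegral_toReal_rnDeriv h _

end MeanErgodic

section SetwiseLimit

variable {α : Type*} [MeasurableSpace α]

theorem continuous_measureReal_iUnion_cond (P : Measure α) [IsFiniteMeasure P] {F : ℕ → Set α}
    (hF : ∀ i, MeasurableSet (F i)) (hd : Pairwise (Function.onFun Disjoint F)) :
    Continuous fun S : ℕ → Bool => P.real (⋃ i, bif S i then F i else ∅) := by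
  have hsum : ∀ S : ℕ → Bool, P.real (⋃ i, bif S i then F i else ∅) =
      ∑' i, bif S i then P.real (F i) else 0 := by
    intro S
    rw [measureReal_def, measure_iUnion, ENNReal.tsum_toReal_eq fun _ => measure_ne_top _ _]
    · congr 1
      ext i
      cases S i <;> simp [measureReal_def]
    · intro i j hij
      have := hd hij
      simp only [Function.onFun] at this ⊢
      cases S i <;> cases S j <;> simp [this]
    · intro i
      cases S i <;> simp [hF i]
  simp_rw [hsum]
  refine continuous_tsum (u := fun i => P.real (F i)) (fun i => ?_) ?_ fun i S => ?_
  · exact (continuous_of_discreteTopology (f := fun b : Bool => bif b then P.real (F i) else 0)).comp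
      (continuous_apply i)
  · refine ENNReal.summable_toReal ?_
    rw [← measure_iUnion hd hF]
    exact measure_ne_top _ _
  · cases S i <;> simp [abs_of_nonneg]

/-- If finite measures converge setwise, their mass on the tails of a disjoint sequence is
eventually uniformly close to that of one of them. -/
theorem exists_forall_measureReal_tail_le {P : ℕ → Measure α} [∀ n, IsFiniteMeasure (P n)]
    {L : Set α → ℝ}
    (h : ∀ F, MeasurableSet F → Tendsto (fun n => (P n).real F) atTop (𝓝 (L F)))
    {F : ℕ → Set α} (hF : ∀ i, MeasurableSet (F i)) (hd : Pairwise (Function.onFun Disjoint F))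
    {ε : ℝ} (hε : 0 < ε) :
    ∃ N K, ∀ n ≥ N, ∀ k ≥ K,
      (P n).real (⋃ i, F (i + k)) ≤ (P N).real (⋃ i, F (i + k)) + ε := by
  set V : (ℕ → Bool) → Set α := fun S => ⋃ i, bif S i then F i else ∅ with hV
  have hVm : ∀ S, MeasurableSet (V S) := fun S => MeasurableSet.iUnion fun i => by
    cases S i <;> simp [hF i]
  set E : ℕ → Set (ℕ → Bool) := fun N =>
    {S | ∀ n ≥ N, |(P n).real (V S) - (P N).real (V S)| ≤ ε / 2} with hE
  have hEc : ∀ N, IsClosed (E N) := by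
    intro N
    simp only [hE, Set.ofPred_forall]
    refine isClosed_iInter fun n => isClosed_iInter fun _ => ?_
    exact isClosed_le (((continuous_measureReal_iUnion_cond (P n) hF hd).sub
      (continuous_measureReal_iUnion_cond (P N) hF hd)).abs) continuous_const
  have hEU : ⋃ N, E N = Set.univ := by
    refine Set.eq_univ_of_forall fun S => ?_
    obtain ⟨N, hN⟩ := Metric.cauchySeq_iff'.1 (h _ (hVm S)).cauchySeq (ε / 2) (by positivity)
    exact Set.mem_iUnion.2 ⟨N, fun n hn => (hN n hn).le⟩
  obtain ⟨N, S, hS⟩ := nonempty_interior_of_iUnion_of_closed hEc hEU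
  obtain ⟨I, u, hu, hIu⟩ := isOpen_pi_iff.1 isOpen_interior S hS
  obtain ⟨K, hK⟩ := I.exists_nat_subset_range
  refine ⟨N, K, fun n hn k hk => ?_⟩
  have hmem : ∀ S' : ℕ → Bool, (∀ i < k, S' i = S i) → S' ∈ E N := by
    intro S' hS'
    refine interior_subset (hIu fun i hi => ?_)
    rw [hS' i ((Finset.mem_range.1 (hK hi)).trans_le hk)]
    exact (hu i hi).2
  have h₀ := abs_le.1 (hmem (fun i => if i < k then S i else false) (by simp +contextual) n hn)
  have h₁ := abs_le.1 (hmem (fun i => if i < k then S i else true) (by simp +contextual) n hn)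
  have hunion : V (fun i => if i < k then S i else true) =
      V (fun i => if i < k then S i else false) ∪ ⋃ i, F (i + k) := by
    ext x
    simp only [hV, Set.mem_union, Set.mem_iUnion]
    constructor
    · rintro ⟨i, hi⟩
      by_cases hik : i < k
      · exact Or.inl ⟨i, by simpa [hik] using hi⟩
      · exact Or.inr ⟨i - k, by simpa [hik, Nat.sub_add_cancel (not_lt.1 hik)] using hi⟩
    · rintro (⟨i, hi⟩ | ⟨i, hi⟩)
      · by_cases hik : i < k
        · exact ⟨i, by simpa [hik] using hi⟩
        · simp [hik] at hi
      · exact ⟨i + k, by simpa using hi⟩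
  have hdisj : Disjoint (V fun i => if i < k then S i else false) (⋃ i, F (i + k)) := by
    simp only [hV, Set.disjoint_iUnion_left, Set.disjoint_iUnion_right]
    intro j i
    by_cases hik : i < k
    · have := hd (show i ≠ j + k by omega)
      simp only [Function.onFun] at this
      cases S i <;> simp [hik, this]
    · simp [hik]
  have hadd : ∀ n, (P n).real (V fun i => if i < k then S i else true) =
      (P n).real (V fun i => if i < k then S i else false) + (P n).real (⋃ i, F (i + k)) := by
    intro n
    rw [hunion, measureReal_union hdisj (MeasurableSet.iUnion fun i => hF _)]
  rw [hadd, hadd] at h₁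
  linarith [h₀.1, h₀.2, h₁.1, h₁.2]

/-- **Nikodym convergence theorem**: a setwise limit of finite measures is a finite measure. -/
theorem exists_measure_of_tendsto_setwise {P : ℕ → Measure α} [∀ n, IsFiniteMeasure (P n)]
    {L : Set α → ℝ}
    (h : ∀ F, MeasurableSet F → Tendsto (fun n => (P n).real F) atTop (𝓝 (L F))) :
    ∃ m : Measure α, IsFiniteMeasure m ∧ ∀ F, MeasurableSet F → m.real F = L F := by
  have hnonneg : ∀ F, MeasurableSet F → 0 ≤ L F := fun F hF =>
    ge_of_tendsto' (h F hF) fun _ => measureReal_nonneg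
  have hempty : L ∅ = 0 := tendsto_nhds_unique (h ∅ .empty) (by simp)
  have hunion : ∀ F G, MeasurableSet F → MeasurableSet G → Disjoint F G →
      L (F ∪ G) = L F + L G := by
    intro F G hF hG hd
    refine tendsto_nhds_unique (h _ (hF.union hG)) (((h F hF).add (h G hG)).congr fun n => ?_)
    rw [measureReal_union hd hG]
  have htail : ∀ F : ℕ → Set α, (∀ i, MeasurableSet (F i)) →
      Pairwise (Function.onFun Disjoint F) →
      Tendsto (fun k => L (⋃ i, F (i + k))) atTop (𝓝 0) := by
    intro F hF hd
    have hFt : ∀ k, MeasurableSet (⋃ i, F (i + k)) := fun k => MeasurableSet.iUnion fun i => hF _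
    rw [Metric.tendsto_atTop]
    intro ε hε
    obtain ⟨N, K, hNK⟩ := exists_forall_measureReal_tail_le h hF hd (half_pos hε)
    have hPN : Tendsto (fun k => (P N).real (⋃ i, F (i + k))) atTop (𝓝 0) := by
      have hs : Summable fun i => (P N).real (F i) := by
        refine ENNReal.summable_toReal ?_
        rw [← measure_iUnion hd hF]
        exact measure_ne_top _ _
      refine (tendsto_sum_nat_add fun i => (P N).real (F i)).congr fun k => ?_
      rw [measureReal_def, measure_iUnion _ fun i => hF _,
        ENNReal.tsum_toReal_eq fun _ => measure_ne_top _ _]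
      · rfl
      · exact fun i j hij => hd (by simpa using hij)
    obtain ⟨K', hK'⟩ := Metric.tendsto_atTop.1 hPN (ε / 2) (half_pos hε)
    refine ⟨max K K', fun k hk => ?_⟩
    have h₁ := hK' k (le_of_max_le_right hk)
    rw [Real.dist_eq, sub_zero, abs_of_nonneg measureReal_nonneg] at h₁
    rw [Real.dist_eq, sub_zero, abs_of_nonneg (hnonneg _ (hFt k))]
    have h₂ : L (⋃ i, F (i + k)) ≤ (P N).real (⋃ i, F (i + k)) + ε / 2 :=
      le_of_tendsto (h _ (hFt k)) <| (eventually_ge_atTop N).mono fun n hn =>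
        hNK n hn k (le_of_max_le_left hk)
    linarith
  have hsplit : ∀ F : ℕ → Set α, (∀ i, MeasurableSet (F i)) →
      Pairwise (Function.onFun Disjoint F) → ∀ k,
      ∑ i ∈ Finset.range k, L (F i) = L (⋃ i, F i) - L (⋃ i, F (i + k)) := by
    intro F hF hd k
    induction k with
    | zero => simp
    | succ k ih =>
      have hstep : ⋃ i, F (i + k) = F k ∪ ⋃ i, F (i + (k + 1)) := by
        rw [← Set.union_iUnion_nat_succ fun i => F (i + k)]
        simp [add_assoc, add_comm 1 k]
      rw [Finset.sum_range_succ, ih, hstep, hunion _ _ (hF k) (MeasurableSet.iUnion fun i => hF _)]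
      · ring
      · exact Set.disjoint_iUnion_right.2 fun i => hd (by omega)
  refine ⟨Measure.ofMeasurable (fun F _ => ENNReal.ofReal (L F)) (by simp [hempty]) ?_, ?_, ?_⟩
  · intro F hF hd
    have hs : HasSum (fun i => L (F i)) (L (⋃ i, F i)) := by
      rw [hasSum_iff_tendsto_nat_of_nonneg fun i => hnonneg _ (hF i)]
      simp_rw [hsplit F hF hd]
      simpa using (htail F hF hd).const_sub (L (⋃ i, F i))
    rw [← hs.tsum_eq, ENNReal.ofReal_tsum_of_nonneg (fun i => hnonneg _ (hF i)) hs.summable]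
  · constructor
    rw [Measure.ofMeasurable_apply _ .univ]
    exact ENNReal.ofReal_lt_top
  · intro F hF
    rw [measureReal_def, Measure.ofMeasurable_apply _ hF, ENNReal.toReal_ofReal (hnonneg F hF)]

end SetwiseLimit

section Shift

variable {α : Type*} [MeasurableSpace α] {T : α → α}

theorem Stationary.recurrent {m : Measure α} [IsFiniteMeasure m] (hT : Measurable T)
    (h : Stationary T m) : Recurrent T m := by
  intro F hF
  have hae := (h.measurePreserving hT).conservative.ae_mem_imp_frequently_image_mem
    hF.nullMeasurableSet
  refine measure_mono_null (s := F \ ⋃ k : ℕ, T^[k + 1] ⁻¹' F) ?_ (mem_ae_iff.1 hae)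
  intro x hx hx'
  obtain ⟨n, hn, hnF⟩ := (frequently_atTop.1 (hx' hx.1)) 1
  refine hx.2 (Set.mem_iUnion.2 ⟨n - 1, ?_⟩)
  rwa [Set.mem_preimage, Nat.sub_add_cancel hn]

theorem Stationary.isAMS {m : Measure α} [IsFiniteMeasure m] (hT : Measurable T)
    (h : Stationary T m) : IsAMS T m :=
  .of_absolutelyContinuous hT h .rfl

theorem Recurrent.of_absolutelyContinuous {η η' : Measure α} (h : Recurrent T η') (hη : η ≪ η') :
    Recurrent T η :=
  fun F hF => hη (h F hF)

/-- An AMS probability measure has a stationary mean, which is a stationary probability measure. -/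
theorem IsAMS.exists_isStationaryMean {η : Measure α} [IsProbabilityMeasure η]
    (hT : Measurable T) (h : IsAMS T η) :
    ∃ m : Measure α, IsProbabilityMeasure m ∧ Stationary T m ∧ IsStationaryMean T η m := by
  choose! L hL using h
  have hprob : ∀ k, IsProbabilityMeasure (η.map T^[k]) := fun k =>
    Measure.isProbabilityMeasure_map (hT.iterate k).aemeasurable
  set P : ℕ → Measure α := fun n => ((n : NNReal)⁻¹ : NNReal) • ∑ k ∈ Finset.range n, η.map T^[k] with hP
  have hPreal : ∀ n F, MeasurableSet F → (P n).real F =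
      (∑ k ∈ Finset.range n, (η (T^[k] ⁻¹' F)).toReal) / (n : ℝ) := by
    intro n F hF
    rw [hP, measureReal_nnreal_smul_apply, measureReal_def, Measure.finsetSum_apply,
      ENNReal.toReal_sum fun k _ => measure_ne_top _ _, div_eq_inv_mul]
    simp [Measure.map_apply (hT.iterate _) hF]
  obtain ⟨m, hmfin, hm⟩ := exists_measure_of_tendsto_setwise (P := P) (L := L) fun F hF =>
    (hL F hF).congr fun n => (hPreal n F hF).symm
  have hmean : IsStationaryMean T η m := fun F hF => by
    rw [← measureReal_def, hm F hF]
    exact hL F hF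
  refine ⟨m, ⟨?_⟩, fun F hF => ?_, hmean⟩
  · have hone : m.real Set.univ = 1 := by
      refine tendsto_nhds_unique (hmean _ .univ) (tendsto_const_nhds.congr' ?_)
      filter_upwards [eventually_gt_atTop 0] with n hn
      have : (n : ℝ) ≠ 0 := by positivity
      simp [this]
    rwa [measureReal_def, ENNReal.toReal_eq_one_iff] at hone
  · have hdiff : Tendsto (fun n : ℕ => ((η (T^[n] ⁻¹' F)).toReal - (η F).toReal) / (n : ℝ))
        atTop (𝓝 0) := by
      refine squeeze_zero_norm (fun n => ?_) (tendsto_const_div_atTop_nhds_zero_nat (1 : ℝ))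
      rw [norm_div, Real.norm_natCast]
      gcongr
      have h₁ : η.real (T^[n] ⁻¹' F) ≤ 1 := measureReal_le_one
      have h₂ : η.real F ≤ 1 := measureReal_le_one
      have h₃ : 0 ≤ η.real (T^[n] ⁻¹' F) := measureReal_nonneg
      have h₄ : 0 ≤ η.real F := measureReal_nonneg
      rw [← measureReal_def, ← measureReal_def, Real.norm_eq_abs, abs_le]
      constructor <;> linarith
    rw [← ENNReal.toReal_eq_toReal_iff' (measure_ne_top _ _) (measure_ne_top _ _)]
    have hlim := (hmean F hF).add hdiff
    rw [add_zero] at hlim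
    refine tendsto_nhds_unique (hmean _ (hT hF)) (hlim.congr fun n => ?_)
    rw [← add_div, ← Finset.sum_range_succ_sub_sum (n := n) fun k => (η (T^[k] ⁻¹' F)).toReal,
      Finset.sum_range_succ' (n := n)]
    congr 1
    simp only [Function.iterate_succ', Set.preimage_comp, Function.iterate_zero, Set.preimage_id]
    ring

/-- A recurrent probability measure is dominated by its stationary mean. -/
theorem Recurrent.absolutelyContinuous {η m : Measure α} [IsProbabilityMeasure η]
    [IsFiniteMeasure m] (hT : Measurable T) (h : Recurrent T η) (hm : Stationary T m)
    (hmean : IsStationaryMean T η m) : η ≪ m := by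
  refine Measure.AbsolutelyContinuous.mk fun F hF hF0 => ?_
  set G : Set α := ⋃ k : ℕ, T^[k] ⁻¹' F with hG
  have hGm : MeasurableSet G := MeasurableSet.iUnion fun k => hT.iterate k hF
  have hG0 : m G = 0 := measure_iUnion_null fun k => by
    rw [((hm.measurePreserving hT).iterate k).measure_preimage hF.nullMeasurableSet, hF0]
  have hmono : ∀ x n, T^[n] x ∈ G → x ∈ G := by
    intro x n hx
    obtain ⟨k, hk⟩ := Set.mem_iUnion.1 hx
    refine Set.mem_iUnion.2 ⟨k + n, ?_⟩
    rwa [Set.mem_preimage, Function.iterate_add_apply]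
  have hle : ∀ k j : ℕ, T^[k + j] ⁻¹' G ⊆ T^[k] ⁻¹' G := by
    intro k j x hx
    rw [Set.mem_preimage, add_comm, Function.iterate_add_apply] at hx
    exact hmono _ j hx
  have hconst : ∀ k : ℕ, η (T^[k] ⁻¹' G) = η G := by
    intro k
    induction k with
    | zero => simp
    | succ k ih =>
      refine le_antisymm ((measure_mono (hle k 1)).trans ih.le) ?_
      rw [← ih]
      have hsub : T^[k] ⁻¹' G \ T^[k + 1] ⁻¹' G ⊆
          T^[k] ⁻¹' G \ ⋃ j : ℕ, T^[j + 1] ⁻¹' (T^[k] ⁻¹' G) := by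
        refine Set.sdiff_subset_sdiff_right (Set.iUnion_subset fun j x hx => ?_)
        rw [← Set.preimage_comp, ← Function.iterate_add, ← add_assoc, add_right_comm] at hx
        exact hle (k + 1) j hx
      exact measure_mono_ae (ae_le_set.2 (measure_mono_null hsub (h _ (hT.iterate k hGm))))
  have hlim := hmean G hGm
  simp only [hconst, hG0] at hlim
  have hlim' : Tendsto (fun n : ℕ => (∑ k ∈ Finset.range n, (η G).toReal) / (n : ℝ)) atTop
      (𝓝 (η G).toReal) := by
    refine tendsto_const_nhds.congr' ?_
    filter_upwards [eventually_gt_atTop 0] with n hn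
    have : (n : ℝ) ≠ 0 := by positivity
    simp [this]
  have hη := tendsto_nhds_unique hlim' hlim
  rw [ENNReal.toReal_zero, ENNReal.toReal_eq_zero_iff, or_iff_left (measure_ne_top _ _)] at hη
  exact measure_mono_null (Set.subset_iUnion (fun k : ℕ => T^[k] ⁻¹' F) 0) hη

end Shift

theorem stmt4 {A B : Type*} [MeasurableSpace A] [MeasurableSpace B]
    (TA : A → A) (TB : B → B) (hTA : Measurable TA) (hTB : Measurable TB)
    (ν : Kernel A B) [IsMarkovKernel ν] :
    (∀ (μ : Measure A) [IsProbabilityMeasure μ], Recurrent TA μ → IsAMS TA μ →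
        Recurrent (Prod.map TA TB) (μ ⊗ₘ ν) ∧ IsAMS (Prod.map TA TB) (μ ⊗ₘ ν)) ↔
      (∀ (μ : Measure A) [IsProbabilityMeasure μ], Stationary TA μ →
        Recurrent (Prod.map TA TB) (μ ⊗ₘ ν) ∧ IsAMS (Prod.map TA TB) (μ ⊗ₘ ν)) := by
  constructor
  · intro h μ _ hμ
    exact h μ (hμ.recurrent hTA) (hμ.isAMS hTA)
  · intro h μ _ hrec hams
    have hTAB : Measurable (Prod.map TA TB) := hTA.prodMap hTB
    obtain ⟨m, _, hm, hmean⟩ := hams.exists_isStationaryMean hTA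
    have hac : μ ⊗ₘ ν ≪ m ⊗ₘ ν :=
      (hrec.absolutelyContinuous hTA hm hmean).compProd_left ν
    obtain ⟨hrec', hams'⟩ := h m hm
    obtain ⟨m', _, hm', hmean'⟩ := hams'.exists_isStationaryMean hTAB
    exact ⟨hrec'.of_absolutelyContinuous hac, .of_absolutelyContinuous hTAB hm'
      (hac.trans (hrec'.absolutelyContinuous hTAB hm' hmean'))⟩
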